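/- Theorem 11(ii): Let C be a graphoid of CI relations on [p] and let G_π and G_τ be minimal I-MAPs with respect to C such that G_π ≤ G_τ (G_τ is an independence map of G_π) but G_π and G_τ are not Markov equivalent. Then there exists a minimal I-MAP G_{τ'} with respect to C such that G_{τ'} ≤ G_τ, |G_{τ'}| < |G_τ|, and G_{τ'} is connected to G_τ by a weakly decreasing sequence of covered arrow reversals. -/

import Mathlib

open scoped Classical

namespace GSP

/-- A DAG on the node set `Fin p`, given by its finite set of arrows,
which must form an acyclic relation. -/
structure DAG (p : ℕ) where
  arrows : Finset (Fin p × Fin p)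
  acyclic : ∀ i : Fin p, ¬ Relation.TransGen (fun a b => (a, b) ∈ arrows) i i

variable {p : ℕ}

namespace DAG

/-- `a → b` is an arrow of `G`. -/
def Arrow (G : DAG p) (a b : Fin p) : Prop := (a, b) ∈ G.arrows

/-- The number of arrows of `G`, denoted `|G|`. -/
def numArrows (G : DAG p) : ℕ := G.arrows.card

/-- The set of parents of a node `j` in `G`. -/
noncomputable def parents (G : DAG p) (j : Fin p) : Finset (Fin p) :=
  Finset.univ.filter fun i => G.Arrow i j

/-- Adjacency: `a` and `b` are joined by an arrow in some direction. -/
def Adj (G : DAG p) (a b : Fin p) : Prop := G.Arrow a b ∨ G.Arrow b a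

/-- `b` is a collider between `a` and `c`: both arrows point into `b`. -/
def Collider (G : DAG p) (a b c : Fin p) : Prop := G.Arrow a b ∧ G.Arrow c b

/-- `d` is a (reflexive) descendant of `a` in `G`. -/
def Desc (G : DAG p) (a d : Fin p) : Prop := Relation.ReflTransGen G.Arrow a d

/-- The list of nodes `l` is a d-connecting walk given `S`: consecutive nodes
are adjacent, every internal collider lies in `S` or has a descendant in `S`,
and no internal non-collider lies in `S`. -/
def DConnWalk (G : DAG p) (S : Finset (Fin p)) (l : List (Fin p)) : Prop :=
  l.Chain' G.Adj ∧
  ∀ (m : ℕ) (_ : 1 ≤ m) (h2 : m + 1 < l.length),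
    (G.Collider (l.get ⟨m - 1, by omega⟩) (l.get ⟨m, by omega⟩) (l.get ⟨m + 1, h2⟩) →
      ∃ d ∈ S, G.Desc (l.get ⟨m, by omega⟩) d) ∧
    (¬ G.Collider (l.get ⟨m - 1, by omega⟩) (l.get ⟨m, by omega⟩) (l.get ⟨m + 1, h2⟩) →
      l.get ⟨m, by omega⟩ ∉ S)

/-- `i` and `j` are d-connected given `S` in `G`. -/
def DConn (G : DAG p) (i j : Fin p) (S : Finset (Fin p)) : Prop :=
  ∃ l : List (Fin p), l.head? = some i ∧ l.getLast? = some j ∧ G.DConnWalk S l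

/-- `i` and `j` are d-separated given `S` in `G`. -/
def DSep (G : DAG p) (i j : Fin p) (S : Finset (Fin p)) : Prop := ¬ G.DConn i j S

end DAG

/-- A conditional independence (CI) relation `i ⊥ j | S` on `[p]`. -/
abbrev CIRel (p : ℕ) := Fin p × Fin p × Finset (Fin p)

/-- The set of CI relations encoded by the d-separations of `G`. -/
def CIof (G : DAG p) : Set (CIRel p) :=
  {t | t.1 ≠ t.2.1 ∧ t.1 ∉ t.2.2 ∧ t.2.1 ∉ t.2.2 ∧ G.DSep t.1 t.2.1 t.2.2}

/-- The symmetric closure of a set of CI relations. -/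
def symClosure (C : Set (CIRel p)) : Set (CIRel p) :=
  {t | t ∈ C ∨ (t.2.1, t.1, t.2.2) ∈ C}

/-- Symmetry of a set of CI relations. -/
def SymmetricCI (C : Set (CIRel p)) : Prop :=
  ∀ i j S, (i, j, S) ∈ C → (j, i, S) ∈ C

/-- A semigraphoid: symmetric and satisfying (SG2). -/
def Semigraphoid (C : Set (CIRel p)) : Prop :=
  SymmetricCI C ∧
  ∀ i j k S, (i, j, S) ∈ C → (i, k, insert j S) ∈ C →
    (i, k, S) ∈ C ∧ (i, j, insert k S) ∈ C

/-- A graphoid: a semigraphoid additionally satisfying intersection (INT). -/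
def Graphoid (C : Set (CIRel p)) : Prop :=
  Semigraphoid C ∧
  ∀ i j k S, (i, j, insert k S) ∈ C → (i, k, insert j S) ∈ C →
    (i, j, S) ∈ C ∧ (i, k, S) ∈ C

/-- Build a DAG from a relation compatible with a numeric ordering. -/
noncomputable def mkDAG (R : Fin p → Fin p → Prop) (f : Fin p → ℕ)
    (hf : ∀ a b, R a b → f a < f b) : DAG p where
  arrows := Finset.univ.filter fun e : Fin p × Fin p => R e.1 e.2
  acyclic := by
    intro i hi
    have key : ∀ a b : Fin p,
        Relation.TransGen (fun a b : Fin p =>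
          (a, b) ∈ Finset.univ.filter fun e : Fin p × Fin p => R e.1 e.2) a b →
        f a < f b := by
      intro a b h
      induction h with
      | single h => exact hf _ _ (by simpa using h)
      | tail _ h ih => exact lt_trans ih (hf _ _ (by simpa using h))
    exact lt_irrefl _ (key i i hi)

/-- The conditioning set `{π_1, …, π_j} \ {π_i, π_j}` (where `b = π_j` is the
later node and `a = π_i` the earlier one) used in the definition of minimal
I-MAPs. -/
noncomputable def condSet (π : Equiv.Perm (Fin p)) (a b : Fin p) : Finset (Fin p) :=
  ((Finset.univ.filter fun k : Fin p => π.symm k ≤ π.symm b).erase a).erase b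

/-- The minimal I-MAP `G_π` of a set `C` of CI relations with respect to the
permutation (ordering) `π`: there is an arrow `π_i → π_j` for positions `i < j`
iff `π_i ⊥ π_j | {π_1, …, π_j} \ {π_i, π_j}` is not in `C`. -/
noncomputable def minimalIMAP (C : Set (CIRel p)) (π : Equiv.Perm (Fin p)) : DAG p :=
  mkDAG (fun a b => π.symm a < π.symm b ∧ (a, b, condSet π a b) ∉ C)
    (fun a => (π.symm a : ℕ)) (fun a b h => by exact_mod_cast h.1)

/-- Markov equivalence of DAGs: equal sets of d-separation statements. -/
def MarkovEquiv (G H : DAG p) : Prop := CIof G = CIof H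

/-- `H` is an independence map of `G`, written `G ≤ H`: `CI(H) ⊆ CI(G)`. -/
def IMapLE (G H : DAG p) : Prop := CIof H ⊆ CIof G

/-- `π` is a linear extension of `G`: every arrow goes from an earlier to a
later element of `π`. -/
def IsLinExt (G : DAG p) (π : Equiv.Perm (Fin p)) : Prop :=
  ∀ a b, G.Arrow a b → π.symm a < π.symm b

/-- `a → b` is a covered arrow of `G`: `pa(a) = pa(b) \ {a}`. -/
def DAG.Covered (G : DAG p) (a b : Fin p) : Prop :=
  G.Arrow a b ∧ G.parents a = (G.parents b).erase a

/-- The minimal I-MAPs `G_σ` and `G_ρ` are connected by a covered arrow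
reversal: `ρ` is a linear extension of the DAG obtained from `G_σ` by
reversing one covered arrow of `G_σ`. -/
def CoveredReversalStep (C : Set (CIRel p)) (σ ρ : Equiv.Perm (Fin p)) : Prop :=
  ∃ a b : Fin p, (minimalIMAP C σ).Covered a b ∧
    ρ.symm b < ρ.symm a ∧
    ∀ x y : Fin p, (minimalIMAP C σ).Arrow x y → (x, y) ≠ (a, b) →
      ρ.symm x < ρ.symm y

/-- A weakly decreasing sequence of covered arrow reversals: a sequence of
minimal I-MAPs in which consecutive members are connected by covered arrow
reversals and the number of arrows never increases. -/
def WeaklyDecreasingSeq (C : Set (CIRel p)) (s : List (Equiv.Perm (Fin p))) : Prop :=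
  s.Chain' fun σ ρ => CoveredReversalStep C σ ρ ∧
    (minimalIMAP C ρ).numArrows ≤ (minimalIMAP C σ).numArrows

/-- Some weakly decreasing sequence of covered arrow reversals starting at
`G_π` reaches a minimal I-MAP with strictly fewer arrows. -/
def EscapesByCoveredReversals (C : Set (CIRel p)) (π : Equiv.Perm (Fin p)) : Prop :=
  ∃ (s : List (Equiv.Perm (Fin p))) (τ : Equiv.Perm (Fin p)),
    s.head? = some π ∧ s.getLast? = some τ ∧ WeaklyDecreasingSeq C s ∧
    (minimalIMAP C τ).numArrows < (minimalIMAP C π).numArrows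

/-- The TSP assumption of `C` with respect to `G`. -/
def TSP (C : Set (CIRel p)) (G : DAG p) : Prop :=
  CIof G ⊆ C ∧
  ∀ π : Equiv.Perm (Fin p), ¬ EscapesByCoveredReversals C π →
    MarkovEquiv (minimalIMAP C π) G

/-- The SMR assumption of `C` with respect to `G`. -/
def SMR (C : Set (CIRel p)) (G : DAG p) : Prop :=
  CIof G ⊆ C ∧
  ∀ H : DAG p, CIof H ⊆ C → ¬ MarkovEquiv H G → G.numArrows < H.numArrows

end GSP

namespace GSP

section

variable {p : ℕ}

/-! ### Walk-based reachability -/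

/-- `Reach G T i v b`: some walk from `i` to `v` has all its internal colliders in `T` and no
internal non-collider in `T`; `b` records whether its last arrow points into `v`. -/
inductive Reach (G : DAG p) (T : Finset (Fin p)) (i : Fin p) : Fin p → Bool → Prop
  | start : Reach G T i i false
  | up {u v : Fin p} {b : Bool} : Reach G T i v b → (v ∈ T ↔ b = true) → G.Arrow u v →
      Reach G T i u false
  | down {v c : Fin p} {b : Bool} : Reach G T i v b → v ∉ T → G.Arrow v c → Reach G T i c true

/-- `i` and `j` are joined by a walk that is open given `T`. -/
def Linked (G : DAG p) (T : Finset (Fin p)) (i j : Fin p) : Prop := ∃ b, Reach G T i j b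

theorem DAG.not_arrow_symm (G : DAG p) {a b : Fin p} (h : G.Arrow a b) : ¬ G.Arrow b a :=
  fun h' => G.acyclic a ((Relation.TransGen.single h).tail h')

theorem DAG.Arrow.ne {G : DAG p} {a b : Fin p} (h : G.Arrow a b) : a ≠ b := by
  rintro rfl
  exact G.not_arrow_symm h h

theorem DAG.Desc.eq_of_desc {G : DAG p} {a b : Fin p} (h : G.Desc a b) (h' : G.Desc b a) :
    a = b := by
  rcases Relation.reflTransGen_iff_eq_or_transGen.1 h with h | h
  · exact h.symm
  · exact (G.acyclic a (h.trans_left h')).elim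

theorem Reach.join {G : DAG p} {T : Finset (Fin p)} {i j v : Fin p} {b : Bool}
    (hj : Reach G T j v b) :
    ∀ {a : Bool}, Reach G T i v a → (v ∈ T ↔ a = true ∧ b = true) → Linked G T i j := by
  induction hj with
  | start => exact fun {a} hi _ => ⟨a, hi⟩
  | up _ hu harr ih =>
    intro a hi hv
    exact ih (hi.down (by simpa using hv) harr) (by simpa using hu)
  | down _ hu harr ih =>
    intro a hi hv
    exact ih (hi.up (by simpa using hv) harr) (by simpa using hu)

theorem Linked.symm {G : DAG p} {T : Finset (Fin p)} {i j : Fin p} (hj : j ∉ T)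
    (h : Linked G T i j) : Linked G T j i := by
  obtain ⟨b, hb⟩ := h
  exact hb.join .start (by simpa using hj)

theorem Reach.of_insert {G : DAG p} {T : Finset (Fin p)} {i k v : Fin p} {b : Bool}
    (h : Reach G (insert k T) i v b) : Reach G T i v b ∨ Linked G T i k := by
  induction h with
  | start => exact .inl .start
  | @up u v b _ hu harr ih =>
    rcases ih with ih | ih
    · by_cases hvk : v = k
      · exact .inr ⟨b, hvk ▸ ih⟩
      · exact .inl (ih.up (by simpa [hvk] using hu) harr)
    · exact .inr ih
  | @down v c b _ hu harr ih =>
    rcases ih with ih | ih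
    · exact .inl (ih.down (fun h => hu (Finset.mem_insert_of_mem h)) harr)
    · exact .inr ih

theorem Linked.of_insert {G : DAG p} {T : Finset (Fin p)} {i j k : Fin p}
    (h : Linked G (insert k T) i j) : Linked G T i j ∨ Linked G T i k := by
  obtain ⟨b, hb⟩ := h
  exact hb.of_insert.imp_left fun h => ⟨b, h⟩

theorem Reach.insert_or {G : DAG p} {T : Finset (Fin p)} {i k v : Fin p} {b : Bool}
    (h : Reach G T i v b) : Reach G (insert k T) i v b ∨ Linked G T i k := by
  induction h with
  | start => exact .inl .start
  | @up u v b h hu harr ih =>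
    rcases ih with ih | ih
    · by_cases hvk : v = k
      · exact .inr ⟨b, hvk ▸ h⟩
      · exact .inl (ih.up (by simpa [hvk] using hu) harr)
    · exact .inr ih
  | @down v c b h hu harr ih =>
    rcases ih with ih | ih
    · by_cases hvk : v = k
      · exact .inr ⟨b, hvk ▸ h⟩
      · exact .inl (ih.down (by simpa [hvk] using hu) harr)
    · exact .inr ih

theorem Reach.avoid_or {G : DAG p} {T : Finset (Fin p)} {i j k v : Fin p} {b : Bool}
    (h : Reach G T i v b) :
    Linked G (insert k T) i j ∨ Linked G (insert j T) i k ∨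
      (v ≠ j ∧ v ≠ k ∧ Reach G (insert j T) i v b ∧ Reach G (insert k T) i v b) := by
  have aux : ∀ {u : Fin p} {b : Bool},
      Reach G (insert j T) i u b → Reach G (insert k T) i u b →
      Linked G (insert k T) i j ∨ Linked G (insert j T) i k ∨
        (u ≠ j ∧ u ≠ k ∧ Reach G (insert j T) i u b ∧ Reach G (insert k T) i u b) := by
    intro u b h₁ h₂
    by_cases huj : u = j
    · exact .inl ⟨b, huj ▸ h₂⟩
    by_cases huk : u = k
    · exact .inr (.inl ⟨b, huk ▸ h₁⟩)
    exact .inr (.inr ⟨huj, huk, h₁, h₂⟩)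
  induction h with
  | start => exact aux .start .start
  | @up u v b _ hu harr ih =>
    rcases ih with ih | ih | ⟨hj, hk, h₁, h₂⟩
    · exact .inl ih
    · exact .inr (.inl ih)
    · exact aux (h₁.up (by simpa [hj] using hu) harr) (h₂.up (by simpa [hk] using hu) harr)
  | @down v c b _ hu harr ih =>
    rcases ih with ih | ih | ⟨hj, hk, h₁, h₂⟩
    · exact .inl ih
    · exact .inr (.inl ih)
    · exact aux (h₁.down (by simpa [hj] using hu) harr) (h₂.down (by simpa [hk] using hu) harr)

/-- A walk starting outside a child-closed set `B` disjoint from the conditioning set can leave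
`B` no more, so conditioning on further nodes of `B` keeps it open. -/
theorem Reach.insert_of_childClosed {G : DAG p} {T : Finset (Fin p)} {B : Set (Fin p)}
    {i n v : Fin p} {b : Bool} (hB : ∀ u w, u ∈ B → G.Arrow u w → w ∈ B)
    (hT : ∀ u ∈ T, u ∉ B) (hi : i ∉ B) (hn : n ∈ B) (h : Reach G T i v b) :
    (v ∉ B ∧ Reach G (insert n T) i v b) ∨
      (v ∈ B ∧ b = true ∧ ((∀ u, G.Arrow u v → u ∉ B) → Reach G (insert n T) i v true)) := by
  have ne : ∀ {u}, u ∉ B → u ≠ n := fun hu h => hu (h ▸ hn)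
  induction h with
  | start => exact .inl ⟨hi, .start⟩
  | @up u v b _ hu harr ih =>
    rcases ih with ⟨hv, ih⟩ | ⟨hv, rfl, -⟩
    · exact .inl ⟨fun h => hv (hB _ _ h harr), ih.up (by simpa [ne hv] using hu) harr⟩
    · exact (hT v (by simpa using hu) hv).elim
  | @down v c b _ hu harr ih =>
    rcases ih with ⟨hv, ih⟩ | ⟨hv, rfl, -⟩
    · have hc := ih.down (by simpa [ne hv] using hu) harr
      by_cases hcB : c ∈ B
      · exact .inr ⟨hcB, rfl, fun _ => hc⟩
      · exact .inl ⟨hcB, hc⟩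
    · exact .inr ⟨hB _ _ hv harr, rfl, fun h => (h v harr hv).elim⟩

theorem Reach.false_of_desc {G : DAG p} {T : Finset (Fin p)} {i v d : Fin p}
    (hd : d ∈ T) (hvd : G.Desc v d) : Reach G T i v true → v ∈ T ∨ Reach G T i v false := by
  induction hvd using Relation.ReflTransGen.head_induction_on with
  | refl => exact fun _ => .inl hd
  | @head a c hac _ ih =>
    intro h
    by_cases ha : a ∈ T
    · exact .inl ha
    · refine .inr ?_
      have hc := h.down ha hac
      by_cases hcT : c ∈ T
      · exact hc.up (by simpa using hcT) hac
      · exact ((ih hc).resolve_left hcT).up (by simpa using hcT) hac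

theorem Reach.linked_of_desc {G : DAG p} {T : Finset (Fin p)} {i v d : Fin p} {b : Bool}
    (hvd : G.Desc v d) (h : Reach G T i v b) (hT : ∀ t ∈ T, ¬ G.Desc v t) : Linked G T i d := by
  induction hvd using Relation.ReflTransGen.head_induction_on generalizing b with
  | refl => exact ⟨b, h⟩
  | @head a c hac _ ih =>
    exact ih (h.down (fun ha => hT a ha .refl) hac)
      fun t ht hct => hT t ht (Relation.ReflTransGen.head hac hct)

/-! ### d-connection as reachability -/

theorem dConnWalk_cons_cons {G : DAG p} {S : Finset (Fin p)} {a b c : Fin p} {l : List (Fin p)} :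
    G.DConnWalk S (a :: b :: c :: l) ↔ G.Adj a b ∧
      ((G.Collider a b c → ∃ d ∈ S, G.Desc b d) ∧ (¬ G.Collider a b c → b ∉ S)) ∧
      G.DConnWalk S (b :: c :: l) := by
  unfold DAG.DConnWalk
  constructor
  · rintro ⟨h₁, h₂⟩
    refine ⟨(List.isChain_cons_cons.1 h₁).1, h₂ 1 le_rfl (by simp),
      (List.isChain_cons_cons.1 h₁).2, ?_⟩
    rintro (_ | m) hm hm'
    · omega
    · exact h₂ (m + 2) (by omega) (by simpa using hm')
  · rintro ⟨h₁, h₂, h₃, h₄⟩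
    refine ⟨List.isChain_cons_cons.2 ⟨h₁, h₃⟩, ?_⟩
    rintro (_ | _ | m) hm hm'
    · omega
    · exact h₂
    · exact h₄ (m + 1) (by omega) (by simpa using hm')

theorem dConnWalk_pair {G : DAG p} {S : Finset (Fin p)} {a b : Fin p} :
    G.DConnWalk S [a, b] ↔ G.Adj a b := by
  unfold DAG.DConnWalk
  constructor
  · exact fun h => (List.isChain_cons_cons.1 h.1).1
  · refine fun h => ⟨List.isChain_cons_cons.2 ⟨h, List.isChain_singleton _⟩, ?_⟩
    intro m hm hm'
    simp at hm'
    omega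

theorem Reach.of_dConnWalk {G : DAG p} {S : Finset (Fin p)} {i : Fin p} (hi : i ∉ S) :
    ∀ (l : List (Fin p)) (v u : Fin p), G.DConnWalk S (v :: u :: l) →
      (u :: l).getLast? = some i → Reach G S i v (decide (G.Arrow u v))
  | [], v, u, h, hl => by
    obtain rfl : u = i := by simpa using hl
    rcases dConnWalk_pair.1 h with h | h
    · have := (Reach.start (G := G) (T := S) (i := u)).up (by simpa using hi) h
      simpa [G.not_arrow_symm h] using this
    · have := (Reach.start (G := G) (T := S) (i := u)).down hi h
      simpa [h] using this
  | w :: l, v, u, h, hl => by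
    obtain ⟨hvu, ⟨hcol, hnon⟩, hrest⟩ := dConnWalk_cons_cons.1 h
    have ih := Reach.of_dConnWalk hi l u w hrest (by simpa using hl)
    rcases hvu with hvu | hvu
    · simp only [G.not_arrow_symm hvu, decide_false]
      by_cases hwu : G.Arrow w u
      · simp only [hwu, decide_true] at ih
        obtain ⟨d, hd, hud⟩ := hcol ⟨hvu, hwu⟩
        by_cases huS : u ∈ S
        · exact ih.up (by simpa using huS) hvu
        · exact ((ih.false_of_desc hd hud).resolve_left huS).up (by simpa using huS) hvu
      · exact ih.up (by simpa [hwu] using hnon fun h => hwu h.2) hvu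
    · simp only [hvu, decide_true]
      exact ih.down (hnon fun h => G.not_arrow_symm hvu h.1) hvu

theorem Reach.exists_dConnWalk {G : DAG p} {S : Finset (Fin p)} {i v : Fin p} {b : Bool}
    (hi : i ∉ S) (h : Reach G S i v b) :
    (v = i ∧ b = false) ∨ ∃ (u : Fin p) (l : List (Fin p)), G.DConnWalk S (v :: u :: l) ∧
      (u :: l).getLast? = some i ∧ (G.Arrow u v ↔ b = true) := by
  induction h with
  | start => exact .inl ⟨rfl, rfl⟩
  | @up u v b _ hu harr ih =>
    right
    rcases ih with ⟨rfl, rfl⟩ | ⟨w, l, hw, hl, hwv⟩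
    · exact ⟨v, [], dConnWalk_pair.2 (.inl harr), by simp, by simp [G.not_arrow_symm harr]⟩
    · refine ⟨v, w :: l, dConnWalk_cons_cons.2 ⟨.inl harr, ⟨fun h => ?_, fun h => ?_⟩, hw⟩,
        by simpa using hl, by simp [G.not_arrow_symm harr]⟩
      · exact ⟨v, hu.2 (hwv.1 h.2), .refl⟩
      · exact fun hv => h ⟨harr, hwv.2 (hu.1 hv)⟩
  | @down v c b _ hu harr ih =>
    right
    rcases ih with ⟨rfl, rfl⟩ | ⟨w, l, hw, hl, hwv⟩
    · exact ⟨v, [], dConnWalk_pair.2 (.inr harr), by simp, by simp [harr]⟩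
    · refine ⟨v, w :: l, dConnWalk_cons_cons.2 ⟨.inr harr, ⟨fun h => ?_, fun _ => hu⟩, hw⟩,
        by simpa using hl, by simp [harr]⟩
      exact (G.not_arrow_symm harr h.1).elim

theorem dConn_iff_linked {G : DAG p} {S : Finset (Fin p)} {i j : Fin p} (hij : i ≠ j)
    (hi : i ∉ S) (hj : j ∉ S) : G.DConn i j S ↔ Linked G S i j := by
  constructor
  · rintro ⟨l, hh, hl, hw⟩
    refine Linked.symm hi ?_
    match l, hh, hl, hw with
    | [a], hh, hl, _ =>
      exact (hij (by simp at hh hl; rw [← hh, hl])).elim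
    | a :: u :: l, hh, hl, hw =>
      obtain rfl : a = i := by simpa using hh
      exact ⟨_, Reach.of_dConnWalk hj l a u hw (by simpa using hl)⟩
  · intro h
    obtain ⟨b, hb⟩ := h.symm hj
    rcases hb.exists_dConnWalk hj with ⟨h, -⟩ | ⟨u, l, hw, hl, -⟩
    · exact (hij h).elim
    · exact ⟨i :: u :: l, rfl, by simpa using hl, hw⟩

theorem mem_CIof {G : DAG p} {S : Finset (Fin p)} {i j : Fin p} :
    (i, j, S) ∈ CIof G ↔ i ≠ j ∧ i ∉ S ∧ j ∉ S ∧ ¬ Linked G S i j := by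
  unfold CIof DAG.DSep
  constructor
  · rintro ⟨hij, hi, hj, h⟩
    exact ⟨hij, hi, hj, fun h' => h ((dConn_iff_linked hij hi hj).2 h')⟩
  · rintro ⟨hij, hi, hj, h⟩
    exact ⟨hij, hi, hj, fun h' => h ((dConn_iff_linked hij hi hj).1 h')⟩

theorem graphoid_CIof (G : DAG p) : Graphoid (CIof G) := by
  refine ⟨⟨?_, ?_⟩, ?_⟩
  · intro i j S h
    rw [mem_CIof] at h ⊢
    exact ⟨h.1.symm, h.2.2.1, h.2.1, fun h' => h.2.2.2 (h'.symm h.2.1)⟩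
  · intro i j k S h₁ h₂
    rw [mem_CIof] at h₁ h₂
    obtain ⟨hij, hi, hj, h₁⟩ := h₁
    obtain ⟨hik, -, hk, h₂⟩ := h₂
    simp only [Finset.mem_insert, not_or] at hk
    have hk' : ¬ Linked G S i k := by
      rintro ⟨b, hb⟩
      rcases hb.insert_or (k := j) with h | h
      exacts [h₂ ⟨b, h⟩, h₁ h]
    refine ⟨mem_CIof.2 ⟨hik, hi, hk.2, hk'⟩,
      mem_CIof.2 ⟨hij, by simp [hik, hi], by simp [Ne.symm hk.1, hj], fun h => ?_⟩⟩
    exact h.of_insert.elim h₁ hk'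
  · intro i j k S h₁ h₂
    rw [mem_CIof] at h₁ h₂
    obtain ⟨hij, hi, hj, h₁⟩ := h₁
    obtain ⟨hik, -, hk, h₂⟩ := h₂
    simp only [Finset.mem_insert, not_or] at hi hj hk
    constructor
    · refine mem_CIof.2 ⟨hij, hi.2, hj.2, ?_⟩
      rintro ⟨b, hb⟩
      rcases hb.avoid_or (j := j) (k := k) with h | h | h
      exacts [h₁ h, h₂ h, h.1 rfl]
    · refine mem_CIof.2 ⟨hik, hi.2, hk.2, ?_⟩
      rintro ⟨b, hb⟩
      rcases hb.avoid_or (j := j) (k := k) with h | h | h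
      exacts [h₁ h, h₂ h, h.2.1 rfl]

/-! ### Orderings and the pairwise ordered Markov property -/

/-- The nodes preceding `b` in the ordering `π`. -/
noncomputable def before (π : Equiv.Perm (Fin p)) (b : Fin p) : Finset (Fin p) :=
  Finset.univ.filter fun k => π.symm k < π.symm b

theorem mem_before {π : Equiv.Perm (Fin p)} {a b : Fin p} :
    a ∈ before π b ↔ π.symm a < π.symm b := by
  simp [before]

theorem condSet_eq (π : Equiv.Perm (Fin p)) (a b : Fin p) :
    condSet π a b = (before π b).erase a := by
  ext k
  simp only [condSet, before, Finset.mem_erase, Finset.mem_filter, Finset.mem_univ, true_and]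
  constructor
  · rintro ⟨h₁, h₂, h₃⟩
    exact ⟨h₂, lt_of_le_of_ne h₃ (by simpa using h₁)⟩
  · rintro ⟨h₁, h₂⟩
    exact ⟨by rintro rfl; exact lt_irrefl _ h₂, h₁, h₂.le⟩

theorem minimalIMAP_arrow {C : Set (CIRel p)} {π : Equiv.Perm (Fin p)} {a b : Fin p} :
    (minimalIMAP C π).Arrow a b ↔
      π.symm a < π.symm b ∧ (a, b, (before π b).erase a) ∉ C := by
  rw [← condSet_eq]
  simp [minimalIMAP, mkDAG, DAG.Arrow]

theorem DAG.Adj.symm {G : DAG p} {a b : Fin p} (h : G.Adj a b) : G.Adj b a := Or.symm h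

theorem isLinExt_minimalIMAP (C : Set (CIRel p)) (π : Equiv.Perm (Fin p)) :
    IsLinExt (minimalIMAP C π) π :=
  fun _ _ h => (minimalIMAP_arrow.1 h).1

theorem IsLinExt.arrow_iff {G : DAG p} {π : Equiv.Perm (Fin p)} (hG : IsLinExt G π)
    {a b : Fin p} : G.Arrow a b ↔ G.Adj a b ∧ π.symm a < π.symm b :=
  ⟨fun h => ⟨.inl h, hG _ _ h⟩,
    fun ⟨h, hlt⟩ => h.resolve_right fun h => lt_asymm hlt (hG _ _ h)⟩

/-- Every pair not related by `R` is independent in `D` given the other nodes preceding the later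
of the two in the ordering `π`. -/
def OrderedMarkov (D : Set (CIRel p)) (π : Equiv.Perm (Fin p)) (R : Fin p → Fin p → Prop) : Prop :=
  ∀ x y, π.symm x < π.symm y → ¬ R x y → (x, y, (before π y).erase x) ∈ D

theorem OrderedMarkov.mono {D D' : Set (CIRel p)} {π : Equiv.Perm (Fin p)}
    {R R' : Fin p → Fin p → Prop} (h : OrderedMarkov D π R) (hD : D ⊆ D')
    (hR : ∀ x y, R x y → R' x y) : OrderedMarkov D' π R' :=
  fun x y hlt hxy => hD (h x y hlt fun h' => hxy (hR x y h'))

theorem orderedMarkov_minimalIMAP (C : Set (CIRel p)) (π : Equiv.Perm (Fin p)) :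
    OrderedMarkov C π (minimalIMAP C π).Adj := by
  intro x y hlt hxy
  by_contra h
  exact hxy (.inl (minimalIMAP_arrow.2 ⟨hlt, h⟩))

theorem OrderedMarkov.adj_of_minimalIMAP {C : Set (CIRel p)} {π : Equiv.Perm (Fin p)}
    {R : Fin p → Fin p → Prop} (hR : ∀ x y, R x y → R y x) (h : OrderedMarkov C π R) {x y : Fin p}
    (hxy : (minimalIMAP C π).Adj x y) : R x y := by
  by_contra hn
  rcases hxy with hxy | hxy <;> rw [minimalIMAP_arrow] at hxy
  · exact hxy.2 (h x y hxy.1 hn)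
  · exact hxy.2 (h y x hxy.1 fun h' => hn (hR _ _ h'))

theorem orderedMarkov_CIof {G : DAG p} {π : Equiv.Perm (Fin p)} (hG : IsLinExt G π) :
    OrderedMarkov (CIof G) π G.Adj := by
  intro x y hlt hxy
  have hne : x ≠ y := by rintro rfl; exact lt_irrefl _ hlt
  have hy : y ∉ (before π y).erase x := by simp [mem_before]
  refine mem_CIof.2 ⟨hne, by simp, hy, fun h => ?_⟩
  have key : ∀ v b, Reach G ((before π y).erase x) y v b →
      (v = y ∧ b = false) ∨ (v ∈ (before π y).erase x ∧ b = false) ∨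
        (π.symm y < π.symm v ∧ b = true) := by
    intro v b h
    induction h with
    | start => exact .inl ⟨rfl, rfl⟩
    | @up u v b _ hu harr ih =>
      rcases ih with ⟨rfl, rfl⟩ | ⟨hv, rfl⟩ | ⟨hv, rfl⟩
      · refine .inr (.inl ⟨Finset.mem_erase.2 ⟨?_, mem_before.2 (hG _ _ harr)⟩, rfl⟩)
        rintro rfl
        exact hxy (.inl harr)
      · exact absurd (hu.1 hv) (by simp)
      · have := mem_before.1 (Finset.mem_of_mem_erase (hu.2 rfl))
        exact (lt_asymm this hv).elim
    | @down v c b _ hu harr ih =>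
      rcases ih with ⟨rfl, rfl⟩ | ⟨hv, rfl⟩ | ⟨hv, rfl⟩
      · exact .inr (.inr ⟨hG _ _ harr, rfl⟩)
      · exact (hu hv).elim
      · exact .inr (.inr ⟨hv.trans (hG _ _ harr), rfl⟩)
  obtain ⟨b, hb⟩ := h.symm hy
  rcases key x b hb with h | h | h
  · exact hne h.1
  · exact (Finset.notMem_erase _ _ h.1).elim
  · exact lt_asymm hlt h.1

/-- Intersection, repeated: independence of `n` from every single node outside `P` given all the
other nodes of `V` passes to smaller conditioning sets containing `P`. -/
theorem Graphoid.mem_of_subset {D : Set (CIRel p)} (hD : Graphoid D) {n : Fin p}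
    {P V : Finset (Fin p)} (h : ∀ x ∈ V, x ∉ P → (x, n, V.erase x) ∈ D) (R : Finset (Fin p))
    (hPR : P ⊆ R) (hRV : R ⊆ V) : ∀ x ∈ V, x ∉ R → (x, n, R) ∈ D := by
  induction hk : (V \ R).card using Nat.strong_induction_on generalizing R with
  | _ k ih =>
    intro x hxV hxR
    by_cases hz : ∃ z ∈ V, z ∉ R ∧ z ≠ x
    · obtain ⟨z, hzV, hzR, hzx⟩ := hz
      have step : ∀ u ∈ V, u ∉ R → ∀ w ∈ V, w ∉ insert u R → (w, n, insert u R) ∈ D := by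
        intro u huV huR
        refine ih _ ?_ (insert u R) (hPR.trans (Finset.subset_insert _ _))
          (Finset.insert_subset huV hRV) rfl
        rw [← hk]
        refine Finset.card_lt_card ⟨Finset.sdiff_subset_sdiff le_rfl (Finset.subset_insert _ _),
          fun hsub => ?_⟩
        have := hsub (Finset.mem_sdiff.2 ⟨huV, huR⟩)
        simp at this
      have h₁ := step z hzV hzR x hxV (by simp [hxR, hzx.symm])
      have h₂ := step x hxV hxR z hzV (by simp [hzR, hzx])
      exact hD.1.1 _ _ _ (hD.2 n x z R (hD.1.1 _ _ _ h₁) (hD.1.1 _ _ _ h₂)).1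
    · push Not at hz
      have hR : R = V.erase x := by
        ext z
        rw [Finset.mem_erase]
        exact ⟨fun hzR => ⟨by rintro rfl; exact hxR hzR, hRV hzR⟩,
          fun ⟨hzx, hzV⟩ => by_contra fun hzR => hzx (hz z hzV hzR)⟩
      rw [hR]
      exact h x hxV fun hP => hxR (hPR hP)

/-- Contraction, repeated: the nodes of `Q` can be dropped from a conditioning set if they are
independent of `i` given the rest. -/
theorem Semigraphoid.mem_of_union {D : Set (CIRel p)} (hD : Semigraphoid D) {i n : Fin p}
    {S : Finset (Fin p)} (Q : Finset (Fin p)) (hQ : Disjoint Q S)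
    (h : ∀ R ⊆ Q, ∀ x ∈ Q, x ∉ R → (i, x, R ∪ S) ∈ D) (hn : (i, n, Q ∪ S) ∈ D) :
    (i, n, S) ∈ D := by
  induction Q using Finset.induction_on with
  | empty => simpa using hn
  | @insert q Q hq ih =>
    refine ih (hQ.mono_left (Finset.subset_insert _ _)) ?_ ?_
    · exact fun R hR x hx hxR => h R (hR.trans (Finset.subset_insert _ _)) x
        (Finset.mem_insert_of_mem hx) hxR
    · rw [Finset.insert_union] at hn
      exact (hD.2 i q n (Q ∪ S) (h Q (Finset.subset_insert _ _) q (by simp) hq) hn).1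

theorem Linked.of_union {G : DAG p} {S R : Finset (Fin p)} {i j : Fin p} :
    Linked G (R ∪ S) i j → Linked G S i j ∨ ∃ k ∈ R, Linked G S i k := by
  induction R using Finset.induction_on generalizing j with
  | empty => exact fun h => .inl (by simpa using h)
  | @insert r R _ ih =>
    intro h
    rw [Finset.insert_union] at h
    rcases h.of_insert with h | h
    · exact (ih h).imp_right fun ⟨k, hk, h⟩ => ⟨k, Finset.mem_insert_of_mem hk, h⟩
    · rcases ih h with h | ⟨k, hk, h⟩
      · exact .inr ⟨r, by simp, h⟩
      · exact .inr ⟨k, Finset.mem_insert_of_mem hk, h⟩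

theorem CIof_subset_of_orderedMarkov {D : Set (CIRel p)} (hD : Graphoid D) {G : DAG p}
    {π : Equiv.Perm (Fin p)} (hG : IsLinExt G π) (hM : OrderedMarkov D π G.Adj) :
    CIof G ⊆ D := by
  have hCI := graphoid_CIof G
  suffices H : ∀ (m : ℕ) (i j : Fin p) (S : Finset (Fin p)), (π.symm i : ℕ) < m →
      (π.symm j : ℕ) < m → (∀ s ∈ S, (π.symm s : ℕ) < m) → (i, j, S) ∈ CIof G → (i, j, S) ∈ D by
    rintro ⟨i, j, S⟩ h
    exact H p i j S (Fin.isLt _) (Fin.isLt _) (fun _ _ => Fin.isLt _) h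
  intro m
  induction m with
  | zero => exact fun i j S hi => (Nat.not_lt_zero _ hi).elim
  | succ m ih =>
    have last : ∀ (i n : Fin p) (S : Finset (Fin p)), (π.symm i : ℕ) < m →
        (π.symm n : ℕ) = m → (∀ s ∈ S, (π.symm s : ℕ) < m) → (i, n, S) ∈ CIof G →
        (i, n, S) ∈ D := by
      intro i n S hi hn hS h
      obtain ⟨hin, hiS, hnS, hsep⟩ := mem_CIof.1 h
      have hpa : ∀ {x}, x ∈ G.parents n → G.Arrow x n := by simp [DAG.parents]
      have hlt : ∀ {x}, x ∈ before π n ↔ (π.symm x : ℕ) < m := by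
        intro x
        rw [mem_before, Fin.lt_def, hn]
      have hparlt : ∀ {x}, x ∈ G.parents n → (π.symm x : ℕ) < m := fun hx =>
        hlt.1 (mem_before.2 (hG _ _ (hpa hx)))
      have hpar : ∀ q ∈ G.parents n \ S, ¬ Linked G S i q := by
        rintro q hq ⟨b, hb⟩
        rw [Finset.mem_sdiff] at hq
        exact hsep ⟨true, hb.down hq.2 (hpa hq.1)⟩
      have hipar : i ∉ G.parents n := fun hip => hsep ⟨true, Reach.start.down hiS (hpa hip)⟩
      refine hD.1.mem_of_union (G.parents n \ S) Finset.sdiff_disjoint ?_ ?_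
      · intro R hR x hx hxR
        have hR' : ∀ r ∈ R, r ∈ G.parents n := fun r hr => (Finset.mem_sdiff.1 (hR hr)).1
        have hx' := Finset.mem_sdiff.1 hx
        refine ih i x (R ∪ S) hi (hparlt hx'.1) ?_ (mem_CIof.2 ⟨?_, ?_, ?_, ?_⟩)
        · intro s hs
          rcases Finset.mem_union.1 hs with hs | hs
          exacts [hparlt (hR' s hs), hS s hs]
        · rintro rfl
          exact hipar hx'.1
        · rw [Finset.mem_union, not_or]
          exact ⟨fun h => hipar (hR' i h), hiS⟩
        · rw [Finset.mem_union, not_or]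
          exact ⟨hxR, hx'.2⟩
        · intro h
          rcases h.of_union with h | ⟨k, hk, h⟩
          exacts [hpar x hx h, hpar k (hR hk) h]
      · rw [Finset.sdiff_union_self_eq_union]
        refine hD.mem_of_subset (P := G.parents n) (V := before π n) ?_ _
          Finset.subset_union_left ?_ i (hlt.2 hi) ?_
        · intro x hx hxP
          refine hM x n (mem_before.1 hx) ?_
          rw [DAG.Adj, not_or]
          exact ⟨fun h => hxP (by simpa [DAG.parents] using h),
            fun h => lt_asymm (mem_before.1 hx) (hG _ _ h)⟩
        · exact Finset.union_subset (fun x hx => hlt.2 (hparlt hx)) fun x hx => hlt.2 (hS x hx)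
        · rw [Finset.mem_union, not_or]
          exact ⟨hipar, hiS⟩
    intro i j S hi hj hS h
    obtain ⟨hij, hiS, hjS, hsep⟩ := mem_CIof.1 h
    have hinj : ∀ {x y : Fin p}, (π.symm x : ℕ) = π.symm y → x = y := fun h =>
      π.symm.injective (Fin.ext h)
    rcases Nat.lt_succ_iff_lt_or_eq.1 hi with hi | hi
    swap
    · refine hD.1.1 _ _ _ (last j i S ?_ hi ?_ (hCI.1.1 _ _ _ h))
      · exact lt_of_le_of_ne (Nat.lt_succ_iff.1 hj) fun hj => hij (hinj (hi.trans hj.symm))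
      · exact fun s hs => lt_of_le_of_ne (Nat.lt_succ_iff.1 (hS s hs))
          fun hs' => hiS (hinj (hi.trans hs'.symm) ▸ hs)
    rcases Nat.lt_succ_iff_lt_or_eq.1 hj with hj | hj
    swap
    · refine last i j S hi hj ?_ h
      exact fun s hs => lt_of_le_of_ne (Nat.lt_succ_iff.1 (hS s hs))
        fun hs' => hjS (hinj (hj.trans hs'.symm) ▸ hs)
    by_cases hn : ∃ n ∈ S, (π.symm n : ℕ) = m
    swap
    · push Not at hn
      exact ih i j S hi hj (fun s hs => lt_of_le_of_ne (Nat.lt_succ_iff.1 (hS s hs)) (hn s hs)) h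
    obtain ⟨n, hn_mem, hn⟩ := hn
    obtain ⟨S, hnS, rfl⟩ : ∃ S', n ∉ S' ∧ insert n S' = S :=
      ⟨S.erase n, Finset.notMem_erase _ _, Finset.insert_erase hn_mem⟩
    have hS' : ∀ s ∈ S, (π.symm s : ℕ) < m := fun s hs =>
      lt_of_le_of_ne (Nat.lt_succ_iff.1 (hS s (Finset.mem_insert_of_mem hs)))
        fun hs' => hnS (hinj (hn.trans hs'.symm) ▸ hs)
    rw [Finset.mem_insert, not_or] at hiS hjS
    let B : Set (Fin p) := {v | m ≤ (π.symm v : ℕ)}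
    have hB : ∀ u w, u ∈ B → G.Arrow u w → w ∈ B := fun u w hu huw =>
      le_trans hu (Fin.lt_def.1 (hG _ _ huw)).le
    have hSB : ∀ s ∈ S, s ∉ B := fun s hs => not_le.2 (hS' s hs)
    have hnB : n ∈ B := hn.ge
    have hpa : ∀ u, G.Arrow u n → u ∉ B := fun u hu =>
      not_le.2 (hn ▸ Fin.lt_def.1 (hG _ _ hu))
    have key : ∀ {v w : Fin p}, v ∉ B → w ∉ B → Linked G S v w →
        Linked G (insert n S) v w := by
      rintro v w hv hw ⟨b, hb⟩
      rcases hb.insert_of_childClosed hB hSB hv hnB with h | h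
      exacts [⟨b, h.2⟩, (hw h.1).elim]
    have keyn : ∀ {v : Fin p}, v ∉ B → Linked G S v n → Reach G (insert n S) v n true := by
      rintro v hv ⟨b, hb⟩
      rcases hb.insert_of_childClosed hB hSB hv hnB with h | h
      exacts [(h.1 hnB).elim, h.2.2 hpa]
    have hiB : i ∉ B := not_le.2 hi
    have hjB : j ∉ B := not_le.2 hj
    have hijS : (i, j, S) ∈ CIof G :=
      mem_CIof.2 ⟨hij, hiS.2, hjS.2, fun h => hsep (key hiB hjB h)⟩
    have fin : ∀ {i j : Fin p}, (π.symm i : ℕ) < m → (π.symm j : ℕ) < m → i ≠ n → i ∉ S →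
        (i, j, S) ∈ CIof G → (i, j, insert n S) ∈ CIof G → ¬ Linked G S i n →
        (i, j, insert n S) ∈ D := by
      intro i j hi hj hin hiS h h' hsep
      have hinS : (i, n, S) ∈ CIof G := mem_CIof.2 ⟨hin, hiS, hnS, hsep⟩
      have h₁ := (hCI.1.2 i n j S hinS h').2
      refine (hD.1.2 i j n S (ih i j S hi hj hS' h) (last i n _ hi hn ?_ h₁)).2
      intro s hs
      rcases Finset.mem_insert.1 hs with rfl | hs
      exacts [hj, hS' s hs]
    by_cases hin : Linked G S i n
    · refine hD.1.1 _ _ _ (fin hj hi hjS.1 hjS.2 (hCI.1.1 _ _ _ hijS) (hCI.1.1 _ _ _ h) ?_)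
      exact fun hjn => hsep ((keyn hjB hjn).join (keyn hiB hin) (by simp))
    · exact fin hi hj hiS.1 hiS.2 hijS h hin

/-! ### Exchanging two consecutive nodes -/

/-- The ordering obtained from `π` by exchanging `a` and `b`. -/
def exchange (π : Equiv.Perm (Fin p)) (a b : Fin p) : Equiv.Perm (Fin p) :=
  π.trans (Equiv.swap a b)

theorem exchange_symm_apply (π : Equiv.Perm (Fin p)) (a b x : Fin p) :
    (exchange π a b).symm x = π.symm (Equiv.swap a b x) := by
  simp [exchange]

theorem exchange_exchange (π : Equiv.Perm (Fin p)) (a b : Fin p) :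
    exchange (exchange π a b) b a = π := by
  ext x
  simp [exchange, Equiv.swap_comm b a]

/-- `a` immediately precedes `b` in the ordering `π`. -/
def Consecutive (π : Equiv.Perm (Fin p)) (a b : Fin p) : Prop :=
  (π.symm a : ℕ) + 1 = π.symm b

section Consecutive

variable {π : Equiv.Perm (Fin p)} {a b : Fin p}

theorem Consecutive.lt (h : Consecutive π a b) : π.symm a < π.symm b := by
  rw [Fin.lt_def, ← h]
  exact Nat.lt_succ_self _

theorem Consecutive.ne (h : Consecutive π a b) : a ≠ b := by
  rintro rfl
  exact lt_irrefl _ h.lt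

theorem Consecutive.exchange (h : Consecutive π a b) : Consecutive (exchange π a b) b a := by
  simpa [Consecutive, exchange_symm_apply] using h

theorem exchange_lt_iff (h : Consecutive π a b) {x y : Fin p} (h₁ : ¬ (x = a ∧ y = b))
    (h₂ : ¬ (x = b ∧ y = a)) :
    (exchange π a b).symm x < (exchange π a b).symm y ↔ π.symm x < π.symm y := by
  have ne : ∀ {u v : Fin p}, u ≠ v → (π.symm u : ℕ) ≠ π.symm v := fun huv h =>
    huv (π.symm.injective (Fin.ext h))
  have hab := h
  unfold Consecutive at hab
  simp only [exchange_symm_apply, Fin.lt_def]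
  by_cases hxa : x = a
  · subst hxa
    by_cases hya : y = x
    · subst hya; simp
    have hyb : y ≠ b := fun h => h₁ ⟨rfl, h⟩
    have := ne hya
    have := ne hyb
    rw [Equiv.swap_apply_left, Equiv.swap_apply_of_ne_of_ne hya hyb]
    omega
  by_cases hxb : x = b
  · subst hxb
    by_cases hyb : y = x
    · subst hyb; simp
    have hya : y ≠ a := fun h => h₂ ⟨rfl, h⟩
    have := ne hya
    have := ne hyb
    rw [Equiv.swap_apply_right, Equiv.swap_apply_of_ne_of_ne hya hyb]
    omega
  have := ne hxa
  have := ne hxb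
  rw [Equiv.swap_apply_of_ne_of_ne hxa hxb]
  by_cases hya : y = a
  · subst hya
    rw [Equiv.swap_apply_left]
    omega
  by_cases hyb : y = b
  · subst hyb
    rw [Equiv.swap_apply_right]
    omega
  rw [Equiv.swap_apply_of_ne_of_ne hya hyb]

theorem Consecutive.before_right (h : Consecutive π a b) :
    before π b = insert a (before π a) := by
  ext x
  rw [Finset.mem_insert, mem_before, mem_before, Fin.lt_def, Fin.lt_def, ← h, Nat.lt_succ_iff,
    Nat.le_iff_lt_or_eq, or_comm, Fin.val_inj, π.symm.injective.eq_iff]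

theorem Consecutive.before_exchange_right (h : Consecutive π a b) :
    before (GSP.exchange π a b) b = before π a := by
  ext x
  rw [mem_before, mem_before]
  by_cases hx : x = a
  · subst hx
    simpa using h.exchange.lt.le
  by_cases hxb : x = b
  · subst hxb
    simpa using h.lt.le
  rw [exchange_lt_iff h (by simp [hx]) (by simp [hxb])]
  have : x ∈ before π b ↔ x ∈ before π a := by
    rw [h.before_right, Finset.mem_insert, or_iff_right hx]
  rwa [mem_before, mem_before] at this

theorem Consecutive.before_exchange_left (h : Consecutive π a b) :
    before (GSP.exchange π a b) a = insert b (before π a) := by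
  rw [h.exchange.before_right, h.before_exchange_right]

theorem before_exchange_of_ne (h : Consecutive π a b) {y : Fin p} (hya : y ≠ a) (hyb : y ≠ b) :
    before (exchange π a b) y = before π y := by
  ext x
  rw [mem_before, mem_before, exchange_lt_iff h (by simp [hyb]) (by simp [hya])]

theorem OrderedMarkov.exchange {D : Set (CIRel p)} (hD : Graphoid D) {R : Fin p → Fin p → Prop}
    (hR : ∀ x y, R x y → R y x) (h : Consecutive π a b)
    (hab : ¬ R a b ∨ ∀ x ∈ before π a, (R x a ↔ R x b)) (hM : OrderedMarkov D π R) :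
    OrderedMarkov D (exchange π a b) R := by
  have hbS : b ∉ before π a := by
    rw [mem_before]
    exact h.lt.asymm
  have haS : a ∉ before π a := by simp [mem_before]
  have before_b : ∀ x ∈ before π a, (before π b).erase x = insert a ((before π a).erase x) := by
    intro x hx
    rw [h.before_right, Finset.erase_insert_of_ne]
    rintro rfl
    exact haS hx
  have ind_ab : ¬ R a b → (a, b, before π a) ∈ D := by
    intro hn
    simpa [h.before_right, Finset.erase_insert haS] using hM a b h.lt hn
  have ind_a : ∀ x ∈ before π a, ¬ R x a → (x, a, insert b ((before π a).erase x)) ∈ D := by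
    intro x hx hxa
    have h₁ := hM x a (mem_before.1 hx) hxa
    by_cases hn : R a b
    · have hxb : ¬ R x b := fun h' => hxa (((hab.resolve_left (not_not.2 hn)) x hx).2 h')
      have h₂ := hM x b ((mem_before.1 hx).trans h.lt) hxb
      rw [before_b x hx] at h₂
      exact (hD.1.2 x a b _ h₁ h₂).2
    · have h₂ := ind_ab hn
      rw [← Finset.insert_erase hx] at h₂
      exact hD.1.1 _ _ _ (hD.1.2 a x b _ (hD.1.1 _ _ _ h₁) h₂).2
  have ind_b : ∀ x ∈ before π a, ¬ R x b → (x, b, (before π a).erase x) ∈ D := by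
    intro x hx hxb
    have h₂ := hM x b ((mem_before.1 hx).trans h.lt) hxb
    rw [before_b x hx] at h₂
    by_cases hn : R a b
    · have hxa : ¬ R x a := fun h' => hxb (((hab.resolve_left (not_not.2 hn)) x hx).1 h')
      exact (hD.1.2 x a b _ (hM x a (mem_before.1 hx) hxa) h₂).1
    · have h₁ := ind_ab hn
      rw [← Finset.insert_erase hx] at h₁
      exact hD.1.1 _ _ _ (hD.2 b x a _ (hD.1.1 _ _ _ h₂) (hD.1.1 _ _ _ h₁)).1
  intro x y hlt hxy
  by_cases hya : y = a
  · subst hya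
    rw [h.before_exchange_left]
    have hx := mem_before.2 hlt
    rw [h.before_exchange_left, Finset.mem_insert] at hx
    by_cases hxb : x = b
    · subst hxb
      rw [Finset.erase_insert hbS]
      exact hD.1.1 _ _ _ (ind_ab fun h' => hxy (hR _ _ h'))
    · have hx := hx.resolve_left hxb
      rw [Finset.erase_insert_of_ne (Ne.symm hxb)]
      exact ind_a x hx hxy
  by_cases hyb : y = b
  · subst hyb
    have hx := mem_before.2 hlt
    rw [h.before_exchange_right] at hx ⊢
    exact ind_b x hx hxy
  · rw [before_exchange_of_ne h hya hyb]
    exact hM x y (by rwa [exchange_lt_iff h (by simp [hyb]) (by simp [hya])] at hlt) hxy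

end Consecutive

/-! ### Adjacency in minimal I-MAPs above a given DAG -/

theorem adj_minimalIMAP_iff_linked {C : Set (CIRel p)} {G : DAG p} {π : Equiv.Perm (Fin p)}
    (hGC : CIof G ⊆ C) (hle : IMapLE G (minimalIMAP C π)) {x y : Fin p}
    (hxy : π.symm x < π.symm y) :
    (minimalIMAP C π).Adj x y ↔ Linked G ((before π y).erase x) x y := by
  have hne : x ≠ y := by rintro rfl; exact lt_irrefl _ hxy
  constructor
  · intro h
    have := (minimalIMAP_arrow.1 ((isLinExt_minimalIMAP C π).arrow_iff.2 ⟨h, hxy⟩)).2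
    by_contra hn
    exact this (hGC (mem_CIof.2 ⟨hne, by simp, by simp [mem_before], hn⟩))
  · intro h
    by_contra hn
    exact (mem_CIof.1 (hle (orderedMarkov_CIof (isLinExt_minimalIMAP C π) x y hxy hn))).2.2.2 h

theorem linked_insert_of_linked {G : DAG p} {T : Finset (Fin p)} {w u x : Fin p}
    (hx : x ∉ T) (hu : u ∉ T) (hwT : ∀ t ∈ T, ¬ G.Desc w t) (hwx : ¬ G.Desc w x)
    (hwu : ¬ G.Desc w u) (h : Linked G (insert x T) w u) (hxw : Linked G T x w) :
    Linked G (insert w T) x u := by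
  have hwx' : w ≠ x := fun h => hwx (h ▸ .refl)
  let B : Set (Fin p) := {v | G.Desc w v}
  have hB : ∀ u v, u ∈ B → G.Arrow u v → v ∈ B := fun _ _ hu huv => Relation.ReflTransGen.tail hu huv
  have hpar : ∀ v, G.Arrow v w → v ∉ B := fun v hv hwv =>
    G.acyclic v (Relation.TransGen.head' hv hwv)
  have hwB : w ∈ B := Relation.ReflTransGen.refl
  have into : ∀ {v : Fin p}, v ∉ B → Linked G T v w → Reach G (insert w T) v w true := by
    rintro v hv ⟨b, hb⟩
    rcases hb.insert_of_childClosed hB hwT hv hwB with h | h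
    exacts [(h.1 hwB).elim, h.2.2 hpar]
  rcases ne_or_eq u x with hux | rfl
  swap
  · exact ⟨false, .start⟩
  have hu' : u ∉ insert x T := by simp [hux, hu]
  rcases (h.symm hu').of_insert with h | ⟨b, hb⟩
  · exact (into hwu h).join (into hwx hxw) (by simp)
  · rcases hb.insert_of_childClosed hB hwT hwu hwB with h | h
    · exact Linked.symm (by simp [hwx'.symm, hx]) ⟨b, h.2⟩
    · exact (hwx h.1).elim

theorem linked_of_linked_insert {G : DAG p} {T : Finset (Fin p)} {w u x c : Fin p}
    (hx : x ∉ T) (hw : w ∉ T) (hu : u ∉ T) (huc : G.Desc u c) (hc : c ∈ insert w (insert x T))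
    (h : Linked G (insert x T) w u) (hxu : Linked G (insert w T) x u) : Linked G T x w := by
  by_contra hxw
  have hwx : ¬ Linked G T w x := fun h => hxw (h.symm hx)
  obtain ⟨b₁, h₁⟩ := h.of_insert.resolve_right hwx
  obtain ⟨b₂, h₂⟩ := hxu.of_insert.resolve_right hxw
  have hb : b₁ = true ∧ b₂ = true := by
    by_contra hb
    exact hwx (h₂.join h₁ (by simp [hu, hb]))
  obtain ⟨rfl, rfl⟩ := hb
  by_cases hT : ∃ t ∈ T, G.Desc u t
  · obtain ⟨t, ht, hut⟩ := hT
    have := (h₂.false_of_desc ht hut).resolve_left hu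
    exact hwx (this.join h₁ (by simp [hu]))
  push Not at hT
  rw [Finset.mem_insert, Finset.mem_insert] at hc
  rcases hc with rfl | rfl | hc
  · exact hxw (h₂.linked_of_desc huc hT)
  · exact hwx (h₁.linked_of_desc huc hT)
  · exact hT c hc huc

theorem adj_iff_adj_of_consecutive {C : Set (CIRel p)} {G : DAG p} {π : Equiv.Perm (Fin p)}
    (hGC : CIof G ⊆ C) (hle : IMapLE G (minimalIMAP C π)) {w u c : Fin p}
    (h : Consecutive π w u) (hw : ∀ t ∈ before π w, ¬ G.Desc w t) (hwu : ¬ G.Desc w u)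
    (huc : G.Desc u c) (hc : c ∈ before π u) (hadj : (minimalIMAP C π).Adj w u) {x : Fin p}
    (hx : x ∈ before π w) :
    (minimalIMAP C π).Adj x w ↔ (minimalIMAP C π).Adj x u := by
  have hww : w ∉ before π w := by simp [mem_before]
  have huw : u ∉ before π w := by rw [mem_before]; exact h.lt.asymm
  have hxw : w ≠ x := by rintro rfl; exact hww hx
  rw [adj_minimalIMAP_iff_linked hGC hle h.lt, h.before_right, Finset.erase_insert hww] at hadj
  rw [adj_minimalIMAP_iff_linked hGC hle (mem_before.1 hx),
    adj_minimalIMAP_iff_linked hGC hle ((mem_before.1 hx).trans h.lt), h.before_right,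
    Finset.erase_insert_of_ne hxw]
  rw [h.before_right] at hc
  have hT : x ∉ (before π w).erase x := Finset.notMem_erase _ _
  have hwT : w ∉ (before π w).erase x := fun h => hww (Finset.mem_of_mem_erase h)
  have huT : u ∉ (before π w).erase x := fun h => huw (Finset.mem_of_mem_erase h)
  rw [← Finset.insert_erase hx] at hadj hc
  exact ⟨linked_insert_of_linked hT huT (fun t ht => hw t (Finset.mem_of_mem_erase ht))
    (hw x hx) hwu hadj, linked_of_linked_insert hT hwT huT huc hc hadj⟩

/-! ### Counting arrows -/

theorem two_mul_numArrows (G : DAG p) :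
    2 * G.numArrows = (Finset.univ.filter fun e : Fin p × Fin p => G.Adj e.1 e.2).card := by
  have h : (Finset.univ.filter fun e : Fin p × Fin p => G.Adj e.1 e.2) =
      G.arrows ∪ G.arrows.map (Equiv.prodComm _ _).toEmbedding := by
    ext ⟨x, y⟩
    simp [DAG.Adj, DAG.Arrow]
  rw [h, Finset.card_union_of_disjoint, Finset.card_map, DAG.numArrows, two_mul]
  rw [Finset.disjoint_left]
  rintro ⟨x, y⟩ hxy hyx
  exact G.not_arrow_symm hxy (by simpa [DAG.Arrow] using hyx)

theorem numArrows_le_of_adj {G H : DAG p} (h : ∀ x y, G.Adj x y → H.Adj x y) :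
    G.numArrows ≤ H.numArrows := by
  have := Finset.card_le_card (Finset.monotone_filter_right Finset.univ
    (p := fun e : Fin p × Fin p => G.Adj e.1 e.2) (q := fun e => H.Adj e.1 e.2)
    fun e _ he => h _ _ he)
  rw [← two_mul_numArrows, ← two_mul_numArrows] at this
  omega

theorem adj_of_numArrows_le {G H : DAG p} (h : ∀ x y, G.Adj x y → H.Adj x y)
    (hcard : H.numArrows ≤ G.numArrows) {x y : Fin p} (hxy : H.Adj x y) : G.Adj x y := by
  have := Finset.eq_of_subset_of_card_le (Finset.monotone_filter_right Finset.univ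
    (p := fun e : Fin p × Fin p => G.Adj e.1 e.2) (q := fun e => H.Adj e.1 e.2)
    fun e _ he => h _ _ he) (by rw [← two_mul_numArrows, ← two_mul_numArrows]; omega)
  have hmem : (x, y) ∈ Finset.univ.filter fun e : Fin p × Fin p => H.Adj e.1 e.2 := by
    simpa using hxy
  rw [← this] at hmem
  simpa using hmem

/-! ### Covered arrow reversals -/

section Exchange

variable {C : Set (CIRel p)} {σ : Equiv.Perm (Fin p)} {w u : Fin p}

theorem CIof_subset_of_adj {D : Set (CIRel p)} (hD : Graphoid D) {G H : DAG p}
    {π : Equiv.Perm (Fin p)} (hG : IsLinExt G π) (hH : IsLinExt H π) (hHD : CIof H ⊆ D)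
    (hadj : ∀ x y, H.Adj x y → G.Adj x y) : CIof G ⊆ D :=
  CIof_subset_of_orderedMarkov hD hG ((orderedMarkov_CIof hH).mono hHD hadj)

theorem adj_of_adj_exchange (hC : Graphoid C) (h : Consecutive σ w u)
    (hwu : ¬ (minimalIMAP C σ).Adj w u ∨
      ∀ x ∈ before σ w, ((minimalIMAP C σ).Adj x w ↔ (minimalIMAP C σ).Adj x u))
    (x y : Fin p) (hxy : (minimalIMAP C (exchange σ w u)).Adj x y) : (minimalIMAP C σ).Adj x y :=
  OrderedMarkov.adj_of_minimalIMAP (fun _ _ => DAG.Adj.symm)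
    ((orderedMarkov_minimalIMAP C σ).exchange hC (fun _ _ => DAG.Adj.symm) h hwu) hxy

theorem iMapLE_exchange (hC : Graphoid C) (h : Consecutive σ w u)
    (hwu : ¬ (minimalIMAP C σ).Adj w u ∨
      ∀ x ∈ before σ w, ((minimalIMAP C σ).Adj x w ↔ (minimalIMAP C σ).Adj x u)) :
    IMapLE (minimalIMAP C (exchange σ w u)) (minimalIMAP C σ) := by
  have hM := ((orderedMarkov_CIof (isLinExt_minimalIMAP C (exchange σ w u))).mono subset_rfl
    (adj_of_adj_exchange hC h hwu)).exchange (graphoid_CIof _) (fun _ _ => DAG.Adj.symm) h.exchange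
    (hwu.imp (fun h h' => h h'.symm)
      fun h' x hx => (h' x (by rwa [h.before_exchange_right] at hx)).symm)
  rw [exchange_exchange] at hM
  exact CIof_subset_of_orderedMarkov (graphoid_CIof _) (isLinExt_minimalIMAP C σ) hM

theorem markovEquiv_exchange (hC : Graphoid C) (h : Consecutive σ w u)
    (hwu : ¬ (minimalIMAP C σ).Adj w u ∨
      ∀ x ∈ before σ w, ((minimalIMAP C σ).Adj x w ↔ (minimalIMAP C σ).Adj x u))
    (hcard : (minimalIMAP C σ).numArrows ≤ (minimalIMAP C (exchange σ w u)).numArrows) :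
    MarkovEquiv (minimalIMAP C (exchange σ w u)) (minimalIMAP C σ) := by
  refine subset_antisymm ?_ (iMapLE_exchange hC h hwu)
  have hM := (orderedMarkov_CIof (isLinExt_minimalIMAP C σ)).exchange (graphoid_CIof _)
    (fun _ _ => DAG.Adj.symm) h hwu
  exact CIof_subset_of_orderedMarkov (graphoid_CIof _) (isLinExt_minimalIMAP C _)
    (hM.mono subset_rfl fun x y => adj_of_numArrows_le (adj_of_adj_exchange hC h hwu) hcard)

theorem minimalIMAP_exchange (hC : Graphoid C) (h : Consecutive σ w u)
    (hwu : ¬ (minimalIMAP C σ).Adj w u) :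
    minimalIMAP C (exchange σ w u) = minimalIMAP C σ := by
  have hadj := adj_of_adj_exchange hC h (.inl hwu)
  have hadj' := adj_of_adj_exchange hC h.exchange
    (.inl fun h' => hwu (hadj _ _ h').symm)
  rw [exchange_exchange] at hadj'
  have harr : ∀ x y, (minimalIMAP C (exchange σ w u)).Arrow x y ↔ (minimalIMAP C σ).Arrow x y := by
    intro x y
    rw [(isLinExt_minimalIMAP C _).arrow_iff, (isLinExt_minimalIMAP C _).arrow_iff,
      (⟨hadj x y, hadj' x y⟩ : _ ↔ _)]
    refine and_congr_right fun hxy => exchange_lt_iff h ?_ ?_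
    · rintro ⟨rfl, rfl⟩
      exact hwu hxy
    · rintro ⟨rfl, rfl⟩
      exact hwu hxy.symm
  have : ∀ G H : DAG p, G.arrows = H.arrows → G = H := by
    rintro ⟨_, _⟩ ⟨_, _⟩ rfl
    rfl
  exact this _ _ (Finset.ext fun e => harr e.1 e.2)

theorem coveredReversalStep_exchange {τ : Equiv.Perm (Fin p)}
    (hτ : minimalIMAP C τ = minimalIMAP C σ) (h : Consecutive σ w u)
    (hadj : (minimalIMAP C σ).Adj w u)
    (hwu : ∀ x ∈ before σ w, ((minimalIMAP C σ).Adj x w ↔ (minimalIMAP C σ).Adj x u)) :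
    CoveredReversalStep C τ (exchange σ w u) := by
  have arrow_iff := fun x y => (isLinExt_minimalIMAP C σ).arrow_iff (a := x) (b := y)
  refine ⟨w, u, ?_, h.exchange.lt, ?_⟩
  · rw [hτ]
    refine ⟨(arrow_iff w u).2 ⟨hadj, h.lt⟩, ?_⟩
    ext x
    have hx : x ∈ before σ u ↔ x = w ∨ x ∈ before σ w := by
      rw [h.before_right, Finset.mem_insert]
    simp only [DAG.parents, Finset.mem_filter, Finset.mem_univ, true_and, Finset.mem_erase,
      arrow_iff, ← mem_before, hx]
    have hw : w ∉ before σ w := by simp [mem_before]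
    constructor
    · rintro ⟨hxw, hx⟩
      exact ⟨by rintro rfl; exact hw hx, (hwu x hx).1 hxw, .inr hx⟩
    · rintro ⟨hne, hxu, hx⟩
      have hx := hx.resolve_left hne
      exact ⟨(hwu x hx).2 hxu, hx⟩
  · intro x y hxy hne
    rw [hτ] at hxy
    have hlt := isLinExt_minimalIMAP C σ _ _ hxy
    refine (exchange_lt_iff h ?_ ?_).2 hlt
    · rintro ⟨rfl, rfl⟩
      exact hne rfl
    · rintro ⟨rfl, rfl⟩
      exact lt_asymm hlt h.lt

end Exchange

/-! ### Moving a node in front of its descendants -/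

/-- The pairs `(b, a)` such that `b` precedes `a` in the ordering `σ` although some descendant of
`a` in `G` does not come after `b`. -/
noncomputable def inversions (G : DAG p) (σ : Equiv.Perm (Fin p)) : Finset (Fin p × Fin p) :=
  Finset.univ.filter fun e => σ.symm e.1 < σ.symm e.2 ∧
    ∃ c, σ.symm c ≤ σ.symm e.1 ∧ G.Desc e.2 c

theorem card_inversions_exchange_lt {G : DAG p} {σ : Equiv.Perm (Fin p)} {w u c : Fin p}
    (h : Consecutive σ w u) (hw : ∀ t ∈ before σ w, ¬ G.Desc w t) (hwu : ¬ G.Desc w u)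
    (huc : G.Desc u c) (hc : c ∈ before σ u) :
    (inversions G (exchange σ w u)).card < (inversions G σ).card := by
  have hcw : σ.symm c ≤ σ.symm w := by
    rw [h.before_right, Finset.mem_insert] at hc
    rcases hc with rfl | hc
    exacts [le_rfl, (mem_before.1 hc).le]
  refine Finset.card_lt_card ⟨?_, fun hsub => ?_⟩
  · rintro ⟨b, a⟩ hba
    simp only [inversions, Finset.mem_filter, Finset.mem_univ, true_and] at hba ⊢
    obtain ⟨hlt, d, hd, had⟩ := hba
    have hd' : d = b ∨ d ∈ before (exchange σ w u) b := by
      rw [mem_before]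
      rcases hd.eq_or_lt with hd | hd
      exacts [.inl ((exchange σ w u).symm.injective hd), .inr hd]
    by_cases hbu : b = u
    · subst hbu
      rw [h.before_exchange_right] at hd'
      by_cases haw : a = w
      · subst haw
        rcases hd' with rfl | hd'
        exacts [(hwu had).elim, (hw d hd' had).elim]
      · refine ⟨(exchange_lt_iff h (by simp [h.ne.symm]) (by simp [haw])).1 hlt, d, ?_, had⟩
        rcases hd' with rfl | hd'
        exacts [le_rfl, ((mem_before.1 hd').trans h.lt).le]
    by_cases hbw : b = w
    · subst hbw
      have hau : a ≠ u := by
        rintro rfl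
        exact lt_asymm hlt h.exchange.lt
      refine ⟨(exchange_lt_iff h (by simp [hau]) (by simp [h.ne])).1 hlt, ?_⟩
      rw [h.before_exchange_left, Finset.mem_insert] at hd'
      rcases hd' with rfl | rfl | hd'
      exacts [⟨d, le_rfl, had⟩, ⟨c, hcw, had.trans huc⟩, ⟨d, (mem_before.1 hd').le, had⟩]
    · refine ⟨(exchange_lt_iff h (by simp [hbw]) (by simp [hbu])).1 hlt, d, ?_, had⟩
      rw [before_exchange_of_ne h hbw hbu] at hd'
      rcases hd' with rfl | hd'
      exacts [le_rfl, (mem_before.1 hd').le]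
  · have := @hsub (w, u) (by simpa [inversions] using ⟨h.lt, c, hcw, huc⟩)
    simp only [inversions, Finset.mem_filter, Finset.mem_univ, true_and] at this
    exact lt_asymm this.1 h.exchange.lt

/-- If `σ` is not a linear extension of `G`, take the first node `u` that comes after one of its
descendants, and the node `w` just before it. -/
theorem exists_consecutive_of_not_isLinExt {G : DAG p} {σ : Equiv.Perm (Fin p)}
    (hσ : ¬ IsLinExt G σ) :
    ∃ w u c, Consecutive σ w u ∧ (∀ t ∈ before σ w, ¬ G.Desc w t) ∧ ¬ G.Desc w u ∧
      G.Desc u c ∧ c ∈ before σ u := by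
  have hbad : ∃ n, ∃ u c, (σ.symm u : ℕ) = n ∧ G.Desc u c ∧ c ∈ before σ u := by
    simp only [IsLinExt, not_forall, not_lt] at hσ
    obtain ⟨a, b, hab, hle⟩ := hσ
    refine ⟨_, a, b, rfl, .single hab, mem_before.2 (hle.lt_of_ne fun h => ?_)⟩
    exact hab.ne (σ.symm.injective h).symm
  obtain ⟨u, c, hn, huc, hc⟩ := Nat.find_spec hbad
  have hmin : ∀ v, σ.symm v < σ.symm u → ∀ t ∈ before σ v, ¬ G.Desc v t := fun v hv t ht hvt =>
    Nat.find_min hbad (hn ▸ Fin.lt_def.1 hv) ⟨v, t, rfl, hvt, ht⟩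
  have hpos : (σ.symm c : ℕ) < σ.symm u := mem_before.1 hc
  have hw : Consecutive σ (σ ⟨σ.symm u - 1, by omega⟩) u := by
    simp only [Consecutive, Equiv.symm_apply_apply]
    omega
  generalize σ ⟨σ.symm u - 1, _⟩ = w at hw
  refine ⟨w, u, c, hw, hmin w hw.lt, fun hwu => ?_, huc, hc⟩
  rw [hw.before_right, Finset.mem_insert] at hc
  rcases hc with rfl | hc
  · exact hw.ne (hwu.eq_of_desc huc)
  · exact hmin w hw.lt c hc (hwu.trans huc)

theorem exists_reflTransGen_of_iMapLE {C : Set (CIRel p)} (hC : Graphoid C) {G : DAG p}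
    (hGC : CIof G ⊆ C) {τ σ τ₁ : Equiv.Perm (Fin p)} (hle : IMapLE G (minimalIMAP C τ))
    (hne : ¬ MarkovEquiv G (minimalIMAP C τ))
    (hστ : MarkovEquiv (minimalIMAP C σ) (minimalIMAP C τ))
    (hcard : (minimalIMAP C σ).numArrows = (minimalIMAP C τ).numArrows)
    (hσ : minimalIMAP C τ₁ = minimalIMAP C σ)
    (hseq : Relation.ReflTransGen (fun σ ρ => CoveredReversalStep C σ ρ ∧
      (minimalIMAP C ρ).numArrows ≤ (minimalIMAP C σ).numArrows) τ τ₁) :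
    ∃ τ', IMapLE (minimalIMAP C τ') (minimalIMAP C τ) ∧
      (minimalIMAP C τ').numArrows < (minimalIMAP C τ).numArrows ∧
      Relation.ReflTransGen (fun σ ρ => CoveredReversalStep C σ ρ ∧
        (minimalIMAP C ρ).numArrows ≤ (minimalIMAP C σ).numArrows) τ τ' := by
  induction hk : (inversions G σ).card using Nat.strong_induction_on generalizing σ τ₁ with
  | _ k ih =>
    have hle' : IMapLE G (minimalIMAP C σ) := hστ.subset.trans hle
    have hlin : ¬ IsLinExt G σ := by
      intro hlin
      refine hne (subset_antisymm (Set.Subset.trans ?_ hστ.subset) hle)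
      exact CIof_subset_of_adj (graphoid_CIof _) hlin (isLinExt_minimalIMAP C σ) subset_rfl
        fun _ _ => OrderedMarkov.adj_of_minimalIMAP (fun _ _ => DAG.Adj.symm)
          ((orderedMarkov_CIof hlin).mono hGC fun _ _ => id)
    obtain ⟨w, u, c, h, hw, hwu, huc, hc⟩ := exists_consecutive_of_not_isLinExt hlin
    have hdec := hk ▸ card_inversions_exchange_lt h hw hwu huc hc
    by_cases hadj : (minimalIMAP C σ).Adj w u
    · have hcov : ∀ x ∈ before σ w, _ := fun x hx =>
        adj_iff_adj_of_consecutive hGC hle' h hw hwu huc hc hadj hx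
      have hnum := numArrows_le_of_adj (adj_of_adj_exchange hC h (.inr hcov))
      have hseq' := hseq.tail
        ⟨coveredReversalStep_exchange hσ h hadj hcov, by rwa [hσ]⟩
      rcases hnum.lt_or_eq with hlt | heq
      · exact ⟨exchange σ w u, hστ.superset.trans (iMapLE_exchange hC h (.inr hcov)),
          hcard ▸ hlt, hseq'⟩
      · exact ih _ hdec ((markovEquiv_exchange hC h (.inr hcov) heq.ge).trans hστ)
          (heq.trans hcard) rfl hseq' rfl
    · have heq := minimalIMAP_exchange hC h hadj
      exact ih _ hdec (by rwa [heq]) (by rwa [heq]) (by rw [heq, hσ]) hseq rfl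

end

/-- Theorem 11(ii): if `C` is a graphoid and `G_π ≤ G_τ`
are minimal I-MAPs w.r.t. `C` that are not Markov equivalent, then there is a
minimal I-MAP `G_{τ'}` with `G_{τ'} ≤ G_τ` and `|G_{τ'}| < |G_τ|` that is
connected to `G_τ` by a weakly decreasing sequence of covered arrow
reversals. -/
theorem escape_to_sparser_minimalIMAP
    (p : ℕ) (C : Set (CIRel p)) (hC : Graphoid C)
    (π τ : Equiv.Perm (Fin p))
    (hle : IMapLE (minimalIMAP C π) (minimalIMAP C τ))
    (hne : ¬ MarkovEquiv (minimalIMAP C π) (minimalIMAP C τ)) :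
    ∃ τ' : Equiv.Perm (Fin p),
      IMapLE (minimalIMAP C τ') (minimalIMAP C τ) ∧
      (minimalIMAP C τ').numArrows < (minimalIMAP C τ).numArrows ∧
      ∃ s : List (Equiv.Perm (Fin p)),
        s.head? = some τ ∧ s.getLast? = some τ' ∧ WeaklyDecreasingSeq C s := by
  obtain ⟨τ', hτ', hlt, hseq⟩ := exists_reflTransGen_of_iMapLE hC
    (CIof_subset_of_orderedMarkov hC (isLinExt_minimalIMAP C π) (orderedMarkov_minimalIMAP C π))
    hle hne rfl rfl rfl .refl
  obtain ⟨l, hl, hlast⟩ := List.exists_isChain_cons_of_relationReflTransGen hseq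
  refine ⟨τ', hτ', hlt, τ :: l, rfl, ?_, hl⟩
  rw [List.getLast?_eq_getLast_of_ne_nil (List.cons_ne_nil τ l), hlast]

end GSP
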